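/- arXiv:2308.11238 — 2 statements merged into one kernel-verified Lean document; each statement's English description precedes it below -/
import Mathlib

section
/- Let h be a strictly convex distortion function. Then a copula C is universally optimal for h with linear cost if and only if C = C⁺, where C⁺(u,v) = min(u,v); i.e., the comonotonic copula is the unique universally optimal copula. -/
open MeasureTheory Set ProbabilityTheory

noncomputable section

variable {Ω : Type*} [MeasurableSpace Ω]

/-- An atomless probability measure: every non-null measurable set has a measurable
subset of strictly smaller positive measure. -/
def AtomlessProb (P : Measure Ω) : Prop :=
  ∀ A : Set Ω, MeasurableSet A → 0 < P A →
    ∃ B ⊆ A, MeasurableSet B ∧ 0 < P B ∧ P B < P A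

/-- A distortion function: increasing on `[0,1]` with `h 0 = 0` and `h 1 = 1`. -/
def IsDistortion (h : ℝ → ℝ) : Prop :=
  MonotoneOn h (Icc 0 1) ∧ h 0 = 0 ∧ h 1 = 1

/-- The distorted expectation `E^h[Z]`. -/
def distExp (P : Measure Ω) (h : ℝ → ℝ) (Z : Ω → ℝ) : ℝ :=
  (∫ x in Ioi (0:ℝ), h (P {ω | Z ω > x}).toReal) +
  (∫ x in Iio (0:ℝ), (h (P {ω | Z ω > x}).toReal - 1))

/-- Bounded measurable real random variable. -/
def IsBddRV (X : Ω → ℝ) : Prop :=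
  Measurable X ∧ ∃ M : ℝ, ∀ ω, |X ω| ≤ M

/-- X and Y are comonotonic. -/
def Comonotone (P : Measure Ω) (X Y : Ω → ℝ) : Prop :=
  ∃ f g : ℝ → ℝ, Monotone f ∧ Monotone g ∧
    ∀ᵐ ω ∂P, X ω = f (X ω + Y ω) ∧ Y ω = g (X ω + Y ω)

/-- X and Y are counter-monotonic: X and -Y are comonotonic. -/
def CounterMonotone (P : Measure Ω) (X Y : Ω → ℝ) : Prop :=
  Comonotone P X (fun ω => -Y ω)

def Submodular (c : ℝ → ℝ → ℝ) : Prop :=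
  ∀ x₁ y₁ x₂ y₂ : ℝ,
    c (min x₁ x₂) (min y₁ y₂) + c (max x₁ x₂) (max y₁ y₂) ≤ c x₁ y₁ + c x₂ y₂

def Supermodular (c : ℝ → ℝ → ℝ) : Prop :=
  ∀ x₁ y₁ x₂ y₂ : ℝ,
    c x₁ y₁ + c x₂ y₂ ≤ c (min x₁ x₂) (min y₁ y₂) + c (max x₁ x₂) (max y₁ y₂)

/-- c is monotone: increasing in each argument or decreasing in each argument. -/
def MonotoneCost (c : ℝ → ℝ → ℝ) : Prop :=
  Monotone (fun q : ℝ × ℝ => c q.1 q.2) ∨ Antitone (fun q : ℝ × ℝ => c q.1 q.2)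

/-- A 2-copula. -/
def IsCopula (C : ℝ → ℝ → ℝ) : Prop :=
  (∀ u ∈ Icc (0:ℝ) 1, C u 0 = 0 ∧ C 0 u = 0 ∧ C u 1 = u ∧ C 1 u = u) ∧
  (∀ u₁ u₂ v₁ v₂ : ℝ, u₁ ∈ Icc (0:ℝ) 1 → u₂ ∈ Icc (0:ℝ) 1 →
    v₁ ∈ Icc (0:ℝ) 1 → v₂ ∈ Icc (0:ℝ) 1 → u₁ ≤ u₂ → v₁ ≤ v₂ →
    0 ≤ C u₂ v₂ - C u₂ v₁ - C u₁ v₂ + C u₁ v₁)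

/-- (X, Y) has copula C. -/
def HasCopula (P : Measure Ω) (X Y : Ω → ℝ) (C : ℝ → ℝ → ℝ) : Prop :=
  ∀ x y : ℝ, (P {ω | X ω ≤ x ∧ Y ω ≤ y}).toReal =
    C (P {ω | X ω ≤ x}).toReal (P {ω | Y ω ≤ y}).toReal

/-- C is universally optimal for h with linear cost. -/
def UnivOptimal (P : Measure Ω) (h : ℝ → ℝ) (C : ℝ → ℝ → ℝ) : Prop :=
  ∀ X Y X' Y' : Ω → ℝ, IsBddRV X → IsBddRV Y → IsBddRV X' → IsBddRV Y' →
    HasCopula P X Y C → IdentDistrib X X' P P → IdentDistrib Y Y' P P →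
    distExp P h (fun ω => X ω + Y ω) ≤ distExp P h (fun ω => X' ω + Y' ω)

/-- C is universally maximal for h with linear cost. -/
def UnivMaximal (P : Measure Ω) (h : ℝ → ℝ) (C : ℝ → ℝ → ℝ) : Prop :=
  ∀ X Y X' Y' : Ω → ℝ, IsBddRV X → IsBddRV Y → IsBddRV X' → IsBddRV Y' →
    HasCopula P X Y C → IdentDistrib X X' P P → IdentDistrib Y Y' P P →
    distExp P h (fun ω => X' ω + Y' ω) ≤ distExp P h (fun ω => X ω + Y ω)

/-- C is universally optimal within a class 𝒞 of copulas for h with linear cost. -/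
def UnivOptimalWithin (P : Measure Ω) (h : ℝ → ℝ) (C : ℝ → ℝ → ℝ)
    (𝒞 : Set (ℝ → ℝ → ℝ)) : Prop :=
  ∀ X Y X' Y' : Ω → ℝ, IsBddRV X → IsBddRV Y → IsBddRV X' → IsBddRV Y' →
    HasCopula P X Y C → (∃ C' ∈ 𝒞, HasCopula P X' Y' C') →
    IdentDistrib X X' P P → IdentDistrib Y Y' P P →
    distExp P h (fun ω => X ω + Y ω) ≤ distExp P h (fun ω => X' ω + Y' ω)

/-- C is universally maximal within a class 𝒞 of copulas for h with linear cost. -/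
def UnivMaximalWithin (P : Measure Ω) (h : ℝ → ℝ) (C : ℝ → ℝ → ℝ)
    (𝒞 : Set (ℝ → ℝ → ℝ)) : Prop :=
  ∀ X Y X' Y' : Ω → ℝ, IsBddRV X → IsBddRV Y → IsBddRV X' → IsBddRV Y' →
    HasCopula P X Y C → (∃ C' ∈ 𝒞, HasCopula P X' Y' C') →
    IdentDistrib X X' P P → IdentDistrib Y Y' P P →
    distExp P h (fun ω => X' ω + Y' ω) ≤ distExp P h (fun ω => X ω + Y ω)

/-- The set 𝒞_p of copulas C with C(1-p,1-p) = 1-p. -/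
def copulaSet (p : ℝ) : Set (ℝ → ℝ → ℝ) :=
  {C | IsCopula C ∧ C (1 - p) (1 - p) = 1 - p}

/-- The "first comonotonic, then counter-monotonic" copula C^±_p. -/
def Cpm (p : ℝ) (u v : ℝ) : ℝ :=
  if min u v ≤ 1 - p then min u v else max (u + v - 1) (1 - p)

/-- The "first counter-monotonic, then comonotonic" copula C^∓_p. -/
def Cmp (p : ℝ) (u v : ℝ) : ℝ :=
  if max u v ≤ 1 - p then max (u + v - 1 + p) 0 else min u v

/-- Inverse S-shaped distortion with inflection point p: continuous, concave on (0,p),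
convex on (p,1). -/
def IsISS (h : ℝ → ℝ) (p : ℝ) : Prop :=
  ContinuousOn h (Icc 0 1) ∧ ConcaveOn ℝ (Ioo 0 p) h ∧ ConvexOn ℝ (Ioo p 1) h

/-- Strictly inverse S-shaped distortion with inflection point p. -/
def IsStrictISS (h : ℝ → ℝ) (p : ℝ) : Prop :=
  ContinuousOn h (Icc 0 1) ∧ StrictConcaveOn ℝ (Ioo 0 p) h ∧ StrictConvexOn ℝ (Ioo p 1) h

/-- S-shaped distortion with inflection point p: continuous, convex on (0,p),
concave on (p,1). -/
def IsSS (h : ℝ → ℝ) (p : ℝ) : Prop :=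
  ContinuousOn h (Icc 0 1) ∧ ConvexOn ℝ (Ioo 0 p) h ∧ ConcaveOn ℝ (Ioo p 1) h

/-- Strictly S-shaped distortion with inflection point p. -/
def IsStrictSS (h : ℝ → ℝ) (p : ℝ) : Prop :=
  ContinuousOn h (Icc 0 1) ∧ StrictConvexOn ℝ (Ioo 0 p) h ∧ StrictConcaveOn ℝ (Ioo p 1) h

/-- Left quantile of Z at level t. -/
def leftQuantile (P : Measure Ω) (Z : Ω → ℝ) (t : ℝ) : ℝ :=
  sInf {x : ℝ | t ≤ (P {ω | Z ω ≤ x}).toReal}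

/-- W is (a version of) the upper p-tail transform Z^∨_p of Z: its left-quantile
function is t ↦ Q_{(1-p)+pt}(Z). -/
def IsUpperTail (P : Measure Ω) (p : ℝ) (Z W : Ω → ℝ) : Prop :=
  ∀ t ∈ Ioc (0:ℝ) 1, leftQuantile P W t = leftQuantile P Z ((1 - p) + p * t)

/-- W is (a version of) the lower tail transform Z^∧_p of Z: its left-quantile
function is t ↦ Q_{(1-p)t}(Z). -/
def IsLowerTail (P : Measure Ω) (p : ℝ) (Z W : Ω → ℝ) : Prop :=
  ∀ t ∈ Ioc (0:ℝ) 1, leftQuantile P W t = leftQuantile P Z ((1 - p) * t)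

/-- Expected Shortfall at level p. -/
def ES (P : Measure Ω) (p : ℝ) (Z : Ω → ℝ) : ℝ :=
  (1 / (1 - p)) * ∫ r in p..1, leftQuantile P Z r

section Sierpinski

variable {P : Measure Ω}

lemma exists_half_maximal_superset {A B : Set Ω} {t : ℝ}
    (hB : MeasurableSet B ∧ B ⊆ A ∧ P.real B ≤ t) :
    ∃ B' : Set Ω, (MeasurableSet B' ∧ B' ⊆ A ∧ P.real B' ≤ t) ∧ B ⊆ B' ∧
      ∀ D : Set Ω, MeasurableSet D → B ⊆ D → D ⊆ A → P.real D ≤ t →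
        P.real D - P.real B ≤ 2 * (P.real B' - P.real B) := by
  set S : Set ℝ := {r | ∃ D : Set Ω, (MeasurableSet D ∧ D ⊆ A ∧ P.real D ≤ t) ∧ B ⊆ D ∧
    P.real D = r}
  have hbdd : BddAbove S := ⟨t, by rintro r ⟨D, hD, -, rfl⟩; exact hD.2.2⟩
  have hBS : P.real B ∈ S := ⟨B, hB, subset_rfl, rfl⟩
  have hle : ∀ D : Set Ω, MeasurableSet D → B ⊆ D → D ⊆ A → P.real D ≤ t →
      P.real D ≤ sSup S := fun D h1 h2 h3 h4 => le_csSup hbdd ⟨D, ⟨h1, h3, h4⟩, h2, rfl⟩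
  rcases (le_csSup hbdd hBS).eq_or_lt with heq | hlt
  · refine ⟨B, hB, subset_rfl, fun D h1 h2 h3 h4 => ?_⟩
    have := hle D h1 h2 h3 h4
    linarith
  · obtain ⟨_, ⟨B', hB', hsub, rfl⟩, hr⟩ := exists_lt_of_lt_csSup ⟨_, hBS⟩
      (show (sSup S + P.real B) / 2 < sSup S by linarith)
    refine ⟨B', hB', hsub, fun D h1 h2 h3 h4 => ?_⟩
    have := hle D h1 h2 h3 h4
    linarith

variable [IsProbabilityMeasure P]

lemma AtomlessProb.exists_subset_le_half (hP : AtomlessProb P) {A : Set Ω}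
    (hA : MeasurableSet A) (hpos : 0 < P.real A) :
    ∃ B ⊆ A, MeasurableSet B ∧ 0 < P.real B ∧ P.real B ≤ P.real A / 2 := by
  obtain ⟨B, hBA, hB, h0, h1⟩ := hP A hA (by
    rw [measureReal_def, ENNReal.toReal_pos_iff] at hpos; exact hpos.1)
  have h0' : 0 < P.real B := ENNReal.toReal_pos h0.ne' (measure_ne_top _ _)
  have h1' : P.real B < P.real A := (ENNReal.toReal_lt_toReal (measure_ne_top _ _)
    (measure_ne_top _ _)).2 h1
  have hd : P.real (A \ B) = P.real A - P.real B := measureReal_sdiff hBA hB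
  by_cases hle : P.real B ≤ P.real A / 2
  · exact ⟨B, hBA, hB, h0', hle⟩
  · exact ⟨A \ B, sdiff_subset, hA.diff hB, by linarith, by linarith⟩

lemma AtomlessProb.exists_subset_lt (hP : AtomlessProb P) {A : Set Ω}
    (hA : MeasurableSet A) (hpos : 0 < P.real A) {ε : ℝ} (hε : 0 < ε) :
    ∃ B ⊆ A, MeasurableSet B ∧ 0 < P.real B ∧ P.real B < ε := by
  have key : ∀ n : ℕ, ∃ B ⊆ A, MeasurableSet B ∧ 0 < P.real B ∧
      P.real B ≤ (1 / 2) ^ n := by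
    intro n
    induction n with
    | zero => exact ⟨A, subset_rfl, hA, hpos, by simp⟩
    | succ n ih =>
      obtain ⟨B, hBA, hB, h0, h1⟩ := ih
      obtain ⟨B', hB', hm, h0', h1'⟩ := hP.exists_subset_le_half hB h0
      exact ⟨B', hB'.trans hBA, hm, h0', by rw [pow_succ]; linarith⟩
  obtain ⟨n, hn⟩ := exists_pow_lt_of_lt_one hε (by norm_num : (1 / 2 : ℝ) < 1)
  obtain ⟨B, hBA, hB, h0, h1⟩ := key n
  exact ⟨B, hBA, hB, h0, h1.trans_lt hn⟩

/-- Sierpiński's theorem: an atomless probability takes all intermediate values. -/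
theorem AtomlessProb.exists_subset_measureReal_eq (hP : AtomlessProb P) {A : Set Ω}
    (hA : MeasurableSet A) {t : ℝ} (h0 : 0 ≤ t) (ht : t ≤ P.real A) :
    ∃ B ⊆ A, MeasurableSet B ∧ P.real B = t := by
  choose next hnext hsub hmax using fun B : {B : Set Ω // MeasurableSet B ∧ B ⊆ A ∧
    P.real B ≤ t} => exists_half_maximal_superset B.2
  let B : ℕ → {B : Set Ω // MeasurableSet B ∧ B ⊆ A ∧ P.real B ≤ t} := fun n =>
    Nat.rec ⟨∅, MeasurableSet.empty, empty_subset _, by simpa using h0⟩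
      (fun _ b => ⟨next b, hnext b⟩) n
  have hsucc : ∀ n, (B (n + 1) : Set Ω) = next (B n) := fun n => rfl
  have hmono : Monotone fun n => (B n).1 :=
    monotone_nat_of_le_succ fun n => hsub (B n)
  set U : Set Ω := ⋃ n, (B n).1
  have hU : MeasurableSet U := MeasurableSet.iUnion fun n => (B n).2.1
  have hUA : U ⊆ A := iUnion_subset fun n => (B n).2.2.1
  have hUt : P.real U ≤ t := by
    have hlim : Filter.Tendsto (fun n => P.real (B n).1) Filter.atTop
        (nhds (P.real U)) :=
      (ENNReal.tendsto_toReal (measure_ne_top _ _)).comp (tendsto_measure_iUnion_atTop hmono)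
    exact le_of_tendsto' hlim fun n => (B n).2.2.2
  rcases hUt.eq_or_lt with heq | hlt
  · exact ⟨U, hUA, hU, heq⟩
  exfalso
  obtain ⟨D, hDsub, hD, hD0, hDlt⟩ := hP.exists_subset_lt (hA.diff hU)
    (by rw [measureReal_sdiff hUA hU]; linarith) (sub_pos.2 hlt)
  have hUD : P.real (U ∪ D) = P.real U + P.real D :=
    measureReal_union (disjoint_left.2 fun ω h1 h2 => (hDsub h2).2 h1) hD
  have hgrow : ∀ n : ℕ, n * (P.real D / 2) ≤ P.real (B n).1 := by
    intro n
    induction n with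
    | zero => simp
    | succ n ih =>
      have hBU : (B n).1 ⊆ U := subset_iUnion (fun n => (B n).1) n
      have h1 := hmax (B n) (U ∪ D) (hU.union hD) (hBU.trans subset_union_left)
        (union_subset hUA (hDsub.trans sdiff_subset)) (by linarith)
      have h2 : P.real (B n).1 ≤ P.real U := measureReal_mono hBU
      rw [hsucc]
      push_cast
      linarith
  obtain ⟨n, hn⟩ := exists_nat_gt (1 / (P.real D / 2))
  rw [div_lt_iff₀ (by linarith)] at hn
  have h1 : P.real (B n).1 ≤ 1 := measureReal_le_one
  linarith [hgrow n]

/-- Two events with prescribed probabilities and prescribed probability of the intersection. -/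
lemma AtomlessProb.exists_pair (hP : AtomlessProb P) {u v c : ℝ} (hc : 0 ≤ c)
    (hcu : c ≤ u) (hcv : c ≤ v) (hu : u ≤ 1) (hcuv : u + v - 1 ≤ c) :
    ∃ A B : Set Ω, MeasurableSet A ∧ MeasurableSet B ∧ P.real A = u ∧ P.real B = v ∧
      P.real (A ∩ B) = c := by
  obtain ⟨A, -, hA, hAu⟩ := hP.exists_subset_measureReal_eq MeasurableSet.univ
    (hc.trans hcu) (by simpa using hu)
  obtain ⟨B₁, hB₁A, hB₁, hB₁c⟩ := hP.exists_subset_measureReal_eq hA hc (hcu.trans_eq hAu.symm)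
  obtain ⟨B₂, hB₂A, hB₂, hB₂c⟩ := hP.exists_subset_measureReal_eq hA.compl
    (sub_nonneg.2 hcv) (by rw [probReal_compl_eq_one_sub hA]; linarith)
  refine ⟨A, B₁ ∪ B₂, hA, hB₁.union hB₂, hAu, ?_, ?_⟩
  · rw [measureReal_union (disjoint_left.2 fun ω h1 h2 => hB₂A h2 (hB₁A h1)) hB₂]
    linarith
  · rw [show A ∩ (B₁ ∪ B₂) = B₁ by
      ext ω
      have h1 := @hB₁A ω
      have h2 := @hB₂A ω
      simp only [mem_compl_iff] at h2
      simp only [mem_inter_iff, mem_union]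
      tauto]
    exact hB₁c

end Sierpinski

section Convex

variable {h : ℝ → ℝ} {s : Set ℝ} {p q x y : ℝ}

lemma ConvexOn.add_le_add_of_add_eq (hh : ConvexOn ℝ s h) (hp : p ∈ s) (hq : q ∈ s)
    (hpx : p ≤ x) (hxq : x ≤ q) (hsum : x + y = p + q) : h x + h y ≤ h p + h q := by
  rcases (hpx.trans hxq).eq_or_lt with rfl | hpq
  · obtain rfl : x = p := le_antisymm hxq hpx
    obtain rfl : y = x := by linarith
    rfl
  have hne : q - p ≠ 0 := (sub_pos.2 hpq).ne'
  have ha : 0 ≤ (q - x) / (q - p) := div_nonneg (by linarith) (by linarith)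
  have hb : 0 ≤ (x - p) / (q - p) := div_nonneg (by linarith) (by linarith)
  have hab : (q - x) / (q - p) + (x - p) / (q - p) = 1 := by field_simp; ring
  have h1 := hh.2 hp hq ha hb hab
  have h2 := hh.2 hp hq hb ha (by linarith)
  have hx : (q - x) / (q - p) * p + (x - p) / (q - p) * q = x := by field_simp; ring
  have hy : (x - p) / (q - p) * p + (q - x) / (q - p) * q = y := by
    rw [show y = p + q - x by linarith]; field_simp; ring
  simp only [smul_eq_mul, hx, hy] at h1 h2
  calc h x + h y ≤ ((q - x) / (q - p) + (x - p) / (q - p)) * (h p + h q) := by linarith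
    _ = h p + h q := by rw [hab, one_mul]

lemma StrictConvexOn.add_lt_add_of_add_eq (hh : StrictConvexOn ℝ s h) (hp : p ∈ s) (hq : q ∈ s)
    (hpx : p < x) (hxq : x < q) (hsum : x + y = p + q) : h x + h y < h p + h q := by
  have hpq : p < q := hpx.trans hxq
  have hne : q - p ≠ 0 := (sub_pos.2 hpq).ne'
  have ha : 0 < (q - x) / (q - p) := div_pos (by linarith) (by linarith)
  have hb : 0 < (x - p) / (q - p) := div_pos (by linarith) (by linarith)
  have hab : (q - x) / (q - p) + (x - p) / (q - p) = 1 := by field_simp; ring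
  have h1 := hh.2 hp hq hpq.ne ha hb hab
  have h2 := hh.2 hp hq hpq.ne hb ha (by linarith)
  have hx : (q - x) / (q - p) * p + (x - p) / (q - p) * q = x := by field_simp; ring
  have hy : (x - p) / (q - p) * p + (q - x) / (q - p) * q = y := by
    rw [show y = p + q - x by linarith]; field_simp; ring
  simp only [smul_eq_mul, hx, hy] at h1 h2
  calc h x + h y < ((q - x) / (q - p) + (x - p) / (q - p)) * (h p + h q) := by linarith
    _ = h p + h q := by rw [hab, one_mul]

end Convex

section SetFunction

lemma Finset.sum_range_setFun_add_le {Ω : Type*} {μ : Set Ω → ℝ} (hμ : μ ∅ = 0)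
    {F G : Ω → ℕ} {A : Set Ω} {N : ℕ} (hF : ∀ ω, F ω < N)
    (hGA : ∀ ω ∈ A, G ω = F ω + 1) (hGA' : ∀ ω ∉ A, G ω = F ω)
    (hsup : ∀ k : ℕ, μ {ω | k < F ω} + μ ({ω | k ≤ F ω} ∩ A) ≤
      μ ({ω | k < F ω} ∪ ({ω | k ≤ F ω} ∩ A)) + μ ({ω | k < F ω} ∩ A)) :
    ∑ k ∈ Finset.range N, μ {ω | k < F ω} + μ A ≤ ∑ k ∈ Finset.range N, μ {ω | k < G ω} := by
  have hset : ∀ k : ℕ, {ω | k < F ω} ∪ ({ω | k ≤ F ω} ∩ A) = {ω | k < G ω} := by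
    intro k
    ext ω
    change (k < F ω ∨ k ≤ F ω ∧ ω ∈ A) ↔ k < G ω
    by_cases hω : ω ∈ A
    · rw [hGA ω hω, and_iff_left hω]; omega
    · simp [hω, hGA' ω hω]
  have htel := Finset.sum_range_sub' (fun k => μ ({ω | k ≤ F ω} ∩ A)) N
  have hN : {ω | N ≤ F ω} ∩ A = ∅ := by
    ext ω
    simp [hF ω]
  have h0 : {ω | 0 ≤ F ω} ∩ A = A := by
    ext ω
    simp
  simp only [hN, h0, hμ, sub_zero] at htel
  rw [← htel, ← Finset.sum_add_distrib]
  refine Finset.sum_le_sum fun k _ => ?_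
  have hk := hsup k
  rw [hset k] at hk
  have hk' : {ω | k < F ω} = {ω | k + 1 ≤ F ω} := rfl
  rw [hk'] at hk ⊢
  linarith

lemma Finset.sum_range_setFun_add_sum_le {Ω : Type*} {μ : Set Ω → ℝ} (hμ : μ ∅ = 0)
    {f g : Ω → ℕ} {N : ℕ} (hN : ∀ ω, f ω + g ω < N)
    (hsup : ∀ m k : ℕ, μ {ω | k < f ω + min (g ω) m} +
        μ ({ω | k ≤ f ω + min (g ω) m} ∩ {ω | m < g ω}) ≤
      μ ({ω | k < f ω + min (g ω) m} ∪ ({ω | k ≤ f ω + min (g ω) m} ∩ {ω | m < g ω})) +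
        μ ({ω | k < f ω + min (g ω) m} ∩ {ω | m < g ω})) :
    ∑ k ∈ Finset.range N, μ {ω | k < f ω} + ∑ k ∈ Finset.range N, μ {ω | k < g ω} ≤
      ∑ k ∈ Finset.range N, μ {ω | k < f ω + g ω} := by
  have key : ∀ m : ℕ, ∑ k ∈ Finset.range N, μ {ω | k < f ω} +
      ∑ k ∈ Finset.range m, μ {ω | k < g ω} ≤
      ∑ k ∈ Finset.range N, μ {ω | k < f ω + min (g ω) m} := by
    intro m
    induction m with
    | zero => simp
    | succ m ih =>
      have hstep := Finset.sum_range_setFun_add_le hμ (F := fun ω => f ω + min (g ω) m)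
        (G := fun ω => f ω + min (g ω) (m + 1)) (A := {ω | m < g ω}) (N := N)
        (fun ω => by have := hN ω; omega)
        (fun ω hω => by simp only [mem_ofPred_eq] at hω; omega)
        (fun ω hω => by simp only [mem_ofPred_eq] at hω; omega) (hsup m)
      rw [Finset.sum_range_succ]
      linarith
  have hmin : ∀ ω, min (g ω) N = g ω := fun ω => by have := hN ω; omega
  simpa only [hmin] using key N

variable {P : Measure Ω} [IsProbabilityMeasure P] {h : ℝ → ℝ}

lemma supermodular_comp_measureReal (hconv : ConvexOn ℝ (Icc 0 1) h) {A B : Set Ω}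
    (hB : MeasurableSet B) :
    h (P.real A) + h (P.real B) ≤ h (P.real (A ∪ B)) + h (P.real (A ∩ B)) := by
  rw [add_comm (h (P.real (A ∪ B)))]
  exact hconv.add_le_add_of_add_eq ⟨measureReal_nonneg, measureReal_le_one⟩
    ⟨measureReal_nonneg, measureReal_le_one⟩ (measureReal_mono inter_subset_left)
    (measureReal_mono subset_union_left) (by rw [add_comm (P.real (A ∩ B))]; exact
      (measureReal_union_add_inter hB).symm)

lemma measureReal_eq_of_subset_of_diff_null {A B D : Set Ω} (hAB : A ⊆ B) (hD : B \ A ⊆ D)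
    (h0 : P.real D = 0) : P.real A = P.real B := by
  refine le_antisymm (measureReal_mono hAB) ?_
  calc P.real B ≤ P.real (A ∪ D) := measureReal_mono fun ω hω => by
        by_cases h : ω ∈ A
        · exact Or.inl h
        · exact Or.inr (hD ⟨hω, h⟩)
    _ ≤ P.real A + P.real D := measureReal_union_le _ _
    _ = P.real A := by rw [h0, add_zero]

lemma sum_range_natChoquet_superadditive (hconv : ConvexOn ℝ (Icc 0 1) h) (h0 : h 0 = 0)
    {f g : Ω → ℕ} (hf : Measurable f) (hg : Measurable g) {N : ℕ} (hN : ∀ ω, f ω + g ω < N) :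
    ∑ k ∈ Finset.range N, h (P.real {ω | k < f ω}) +
      ∑ k ∈ Finset.range N, h (P.real {ω | k < g ω}) ≤
      ∑ k ∈ Finset.range N, h (P.real {ω | k < f ω + g ω}) := by
  refine Finset.sum_range_setFun_add_sum_le (μ := fun A => h (P.real A)) (by simpa using h0) hN
    fun m k => ?_
  have hm : MeasurableSet ({ω | k ≤ f ω + min (g ω) m} ∩ {ω | m < g ω}) :=
    (measurableSet_le measurable_const (hf.add (hg.min measurable_const))).inter
      (measurableSet_lt measurable_const hg)
  have := supermodular_comp_measureReal (P := P) hconv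
    (A := {ω | k < f ω + min (g ω) m}) hm
  rwa [← inter_assoc, inter_eq_self_of_subset_left (s := {ω | k < f ω + min (g ω) m})
    (t := {ω | k ≤ f ω + min (g ω) m}) (fun ω (hω : k < _) => hω.le)] at this

/-- Subadditivity when the upper level sets of `f` and `g` are nested up to null sets. -/
lemma sum_range_natChoquet_comonotone (h0 : h 0 = 0) {f g : Ω → ℕ} {N : ℕ}
    (hN : ∀ ω, f ω + g ω < N)
    (hnest : ∀ i j : ℕ, P.real ({ω | i < f ω} \ {ω | j < g ω}) = 0 ∨
      P.real ({ω | j < g ω} \ {ω | i < f ω}) = 0) :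
    ∑ k ∈ Finset.range N, h (P.real {ω | k < f ω + g ω}) ≤
      ∑ k ∈ Finset.range N, h (P.real {ω | k < f ω}) +
      ∑ k ∈ Finset.range N, h (P.real {ω | k < g ω}) := by
  have := Finset.sum_range_setFun_add_sum_le (μ := fun A => -h (P.real A)) (by simpa using h0) hN
    fun m k => ?_
  · simp only [Finset.sum_neg_distrib] at this
    linarith
  set U : Set Ω := {ω | k < f ω + min (g ω) m}
  set W : Set Ω := {ω | k ≤ f ω + min (g ω) m}
  set A : Set Ω := {ω | m < g ω}
  have hUW : U ⊆ W := fun ω (hω : k < _) => hω.le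
  have hcases : P.real (U \ A) = 0 ∨ P.real (A \ U) = 0 := by
    have null_of {S T : Set Ω} (hST : S ⊆ T) (hT : P.real T = 0) : P.real S = 0 :=
      le_antisymm ((measureReal_mono hST).trans_eq hT) measureReal_nonneg
    rcases lt_or_ge k m with hkm | hkm
    · right
      refine null_of (T := ∅) ?_ measureReal_empty
      rintro ω ⟨h1 : m < g ω, h2 : ¬ k < f ω + min (g ω) m⟩
      omega
    · rcases hnest (k - m) m with hn | hn
      · left
        refine null_of ?_ hn
        rintro ω ⟨h1 : k < f ω + min (g ω) m, h2⟩
        exact ⟨show k - m < f ω by omega, h2⟩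
      · right
        refine null_of ?_ hn
        rintro ω ⟨h1 : m < g ω, h2 : ¬ k < f ω + min (g ω) m⟩
        exact ⟨h1, show ¬ k - m < f ω by omega⟩
  rcases hcases with hn | hn
  · have e1 : P.real (W ∩ A) = P.real (U ∪ W ∩ A) :=
      measureReal_eq_of_subset_of_diff_null subset_union_right (by
        rintro ω ⟨h1 | h1, h2⟩
        · exact ⟨h1, fun h3 => h2 ⟨hUW h1, h3⟩⟩
        · exact absurd h1 h2) hn
    have e2 : P.real (U ∩ A) = P.real U :=
      measureReal_eq_of_subset_of_diff_null inter_subset_left (by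
        rintro ω ⟨h1, h2⟩
        exact ⟨h1, fun h3 => h2 ⟨h1, h3⟩⟩) hn
    simp only [e1, e2]
    linarith
  · have e1 : P.real U = P.real (U ∪ W ∩ A) :=
      measureReal_eq_of_subset_of_diff_null subset_union_left (by
        rintro ω ⟨h1 | h1, h2⟩
        · exact absurd h1 h2
        · exact ⟨h1.2, h2⟩) hn
    have e2 : P.real (U ∩ A) = P.real (W ∩ A) :=
      measureReal_eq_of_subset_of_diff_null (inter_subset_inter_left _ hUW) (by
        rintro ω ⟨h1, h2⟩
        exact ⟨h1.2, fun h3 => h2 ⟨h3, h1.2⟩⟩) hn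
    rw [e1, e2]

end SetFunction

section DistortedExpectation

variable {P : Measure Ω} {h : ℝ → ℝ} {Z W : Ω → ℝ}

lemma IsDistortion.tail_eq_zero (hdist : IsDistortion h) {x : ℝ} (hx : ∀ ω, Z ω ≤ x) :
    h (P.real {ω | x < Z ω}) = 0 := by
  have : {ω | x < Z ω} = ∅ := eq_empty_of_forall_notMem fun ω (hω : x < Z ω) =>
    (hx ω).not_gt hω
  rw [this, measureReal_empty, hdist.2.1]

lemma distExp_congr_identDistrib (hZW : IdentDistrib Z W P P) :
    distExp P h Z = distExp P h W := by
  have : ∀ x : ℝ, P {ω | Z ω > x} = P {ω | W ω > x} := fun x =>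
    hZW.measure_mem_eq measurableSet_Ioi
  simp only [distExp, this]

variable [IsProbabilityMeasure P]

lemma IsDistortion.antitone_tail (hdist : IsDistortion h) (Z : Ω → ℝ) :
    Antitone fun x : ℝ => h (P.real {ω | x < Z ω}) := fun x y hxy =>
  hdist.1 ⟨measureReal_nonneg, measureReal_le_one⟩ ⟨measureReal_nonneg, measureReal_le_one⟩
    (measureReal_mono fun ω (hω : y < Z ω) => hxy.trans_lt hω)

lemma IsDistortion.tail_eq_one (hdist : IsDistortion h) {x : ℝ} (hx : ∀ ω, x < Z ω) :
    h (P.real {ω | x < Z ω}) = 1 := by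
  have : {ω | x < Z ω} = univ := eq_univ_of_forall hx
  rw [this, probReal_univ, hdist.2.2]

lemma distExp_eq_intervalIntegral_symm (hdist : IsDistortion h) {M : ℝ} (hM : 0 ≤ M)
    (hZ : ∀ ω, -M ≤ Z ω) (hZ' : ∀ ω, Z ω ≤ M) :
    distExp P h Z = (∫ x in (-M)..M, h (P.real {ω | x < Z ω})) - M := by
  have hanti := hdist.antitone_tail (P := P) Z
  have hpos : ∫ x in Ioi (0 : ℝ), h (P.real {ω | x < Z ω}) =
      ∫ x in (0 : ℝ)..M, h (P.real {ω | x < Z ω}) := by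
    rw [intervalIntegral.integral_of_le hM]
    refine (setIntegral_eq_of_subset_of_forall_sdiff_eq_zero measurableSet_Ioi Ioc_subset_Ioi_self
      fun x hx => hdist.tail_eq_zero fun ω => (hZ' ω).trans ?_)
    by_contra hxM
    exact hx.2 ⟨hx.1, (not_le.1 hxM).le⟩
  have hneg : ∫ x in Iio (0 : ℝ), (h (P.real {ω | x < Z ω}) - 1) =
      ∫ x in (-M)..0, (h (P.real {ω | x < Z ω}) - 1) := by
    rw [intervalIntegral.integral_of_le (neg_nonpos.2 hM), ← integral_Icc_eq_integral_Ioc,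
      ← integral_Iic_eq_integral_Iio]
    refine (setIntegral_eq_of_subset_of_forall_sdiff_eq_zero measurableSet_Iic Icc_subset_Iic_self
      fun x hx => ?_)
    rw [hdist.tail_eq_one fun ω => lt_of_lt_of_le ?_ (hZ ω), sub_self]
    by_contra hxM
    exact hx.2 ⟨not_lt.1 hxM, hx.1⟩
  calc distExp P h Z = (∫ x in Ioi (0 : ℝ), h (P.real {ω | x < Z ω})) +
        ∫ x in Iio (0 : ℝ), (h (P.real {ω | x < Z ω}) - 1) := rfl
    _ = _ := by
      rw [hpos, hneg, intervalIntegral.integral_sub hanti.intervalIntegrable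
        intervalIntegrable_const, ← intervalIntegral.integral_add_adjacent_intervals
        (hanti.intervalIntegrable (a := -M) (b := 0)) (hanti.intervalIntegrable (b := M)),
        intervalIntegral.integral_const]
      simp only [smul_eq_mul]
      ring

lemma distExp_eq_intervalIntegral (hdist : IsDistortion h) {a b : ℝ}
    (hZ : ∀ ω, a ≤ Z ω) (hZ' : ∀ ω, Z ω ≤ b) :
    distExp P h Z = (∫ x in a..b, h (P.real {ω | x < Z ω})) + a := by
  have hanti := hdist.antitone_tail (P := P) Z
  set M := max |a| |b|
  have hMa : -M ≤ a := neg_le.1 ((neg_le_abs a).trans (le_max_left _ _))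
  have hMb : b ≤ M := (le_abs_self b).trans (le_max_right _ _)
  have h1 : ∫ x in (-M)..a, h (P.real {ω | x < Z ω}) = a + M := by
    rw [intervalIntegral.integral_of_le hMa, integral_Ioc_eq_integral_Ioo,
      setIntegral_congr_fun (g := fun _ => (1 : ℝ)) measurableSet_Ioo
        fun x hx => hdist.tail_eq_one fun ω => hx.2.trans_le (hZ ω),
      ← integral_Ioc_eq_integral_Ioo, ← intervalIntegral.integral_of_le hMa]
    simp
  have h2 : ∫ x in b..M, h (P.real {ω | x < Z ω}) = 0 := by
    rw [intervalIntegral.integral_of_le hMb]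
    exact setIntegral_eq_zero_of_forall_eq_zero fun x hx =>
      hdist.tail_eq_zero fun ω => (hZ' ω).trans hx.1.le
  rw [distExp_eq_intervalIntegral_symm hdist ((abs_nonneg a).trans (le_max_left _ _))
    (fun ω => hMa.trans (hZ ω)) (fun ω => (hZ' ω).trans hMb),
    ← intervalIntegral.integral_add_adjacent_intervals
      (hanti.intervalIntegrable (a := -M) (b := a)) hanti.intervalIntegrable,
    ← intervalIntegral.integral_add_adjacent_intervals
      (hanti.intervalIntegrable (a := a) (b := b)) hanti.intervalIntegrable, h1, h2]
  ring

lemma distExp_mono (hdist : IsDistortion h) {M : ℝ} (hZ : ∀ ω, |Z ω| ≤ M)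
    (hW : ∀ ω, |W ω| ≤ M) (hZW : ∀ ω, Z ω ≤ W ω) : distExp P h Z ≤ distExp P h W := by
  have hM : 0 ≤ M := by
    obtain ⟨ω⟩ := nonempty_of_isProbabilityMeasure P
    exact (abs_nonneg _).trans (hZ ω)
  rw [distExp_eq_intervalIntegral_symm hdist hM (fun ω => (abs_le.1 (hZ ω)).1)
      (fun ω => (abs_le.1 (hZ ω)).2),
    distExp_eq_intervalIntegral_symm hdist hM (fun ω => (abs_le.1 (hW ω)).1)
      (fun ω => (abs_le.1 (hW ω)).2)]
  refine sub_le_sub_right (intervalIntegral.integral_mono_on (by linarith)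
    (hdist.antitone_tail Z).intervalIntegrable (hdist.antitone_tail W).intervalIntegrable
    fun x _ => ?_) _
  exact hdist.1 ⟨measureReal_nonneg, measureReal_le_one⟩ ⟨measureReal_nonneg, measureReal_le_one⟩
    (measureReal_mono fun ω (hω : x < Z ω) => hω.trans_le (hZW ω))

lemma distExp_mul_add (hdist : IsDistortion h) {M : ℝ} (hZ : ∀ ω, |Z ω| ≤ M)
    {c : ℝ} (hc : 0 < c) (d : ℝ) :
    distExp P h (fun ω => c * Z ω + d) = c * distExp P h Z + d := by
  have hscale : ∀ ω, c * -M + d ≤ c * Z ω + d ∧ c * Z ω + d ≤ c * M + d := fun ω => by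
    obtain ⟨h1, h2⟩ := abs_le.1 (hZ ω)
    constructor <;> gcongr
  rw [distExp_eq_intervalIntegral hdist (fun ω => (abs_le.1 (hZ ω)).1)
      (fun ω => (abs_le.1 (hZ ω)).2),
    distExp_eq_intervalIntegral hdist (fun ω => (hscale ω).1)
      (fun ω => (hscale ω).2)]
  have hcomp := intervalIntegral.smul_integral_comp_mul_add (a := -M) (b := M)
    (fun x => h (P.real {ω | x < c * Z ω + d})) c d
  simp only [add_lt_add_iff_right, mul_lt_mul_iff_right₀ hc, smul_eq_mul] at hcomp
  rw [← hcomp]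
  ring

lemma distExp_natCast (hdist : IsDistortion h) {f : Ω → ℕ} {N : ℕ} (hN : ∀ ω, f ω ≤ N) :
    distExp P h (fun ω => (f ω : ℝ)) =
      ∑ k ∈ Finset.range N, h (P.real {ω | k < f ω}) := by
  have hanti := hdist.antitone_tail (P := P) fun ω => (f ω : ℝ)
  rw [distExp_eq_intervalIntegral hdist (fun ω => Nat.cast_nonneg (f ω))
    (fun ω => Nat.cast_le.2 (hN ω)), add_zero]
  have hsum := intervalIntegral.sum_integral_adjacent_intervals (μ := volume)
    (f := fun x : ℝ => h (P.real {ω | x < f ω}))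
    (a := fun k : ℕ => (k : ℝ)) (n := N) fun k _ => hanti.intervalIntegrable
  rw [Nat.cast_zero] at hsum
  rw [← hsum]
  refine Finset.sum_congr rfl fun k _ => ?_
  rw [intervalIntegral.integral_of_le (by simp), integral_Ioc_eq_integral_Ioo,
    setIntegral_congr_fun (g := fun _ => h (P.real {ω | k < f ω})) measurableSet_Ioo ?_,
    ← integral_Ioc_eq_integral_Ioo, ← intervalIntegral.integral_of_le (by simp)]
  · simp
  · intro x hx
    have hset : {ω | x < f ω} = {ω | k < f ω} := by
      ext ω
      change x < f ω ↔ k < f ω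
      refine ⟨fun hxf => ?_, fun hkf => hx.2.trans_le (by exact_mod_cast hkf)⟩
      exact_mod_cast hx.1.trans hxf
    simp only [hset]

/-- Rounding sandwich: an integer-valued variable between `n Z + a` and `n Z + b`. -/
lemma distExp_natCast_mem_Icc (hdist : IsDistortion h) {M : ℝ} (hZ : ∀ ω, |Z ω| ≤ M)
    {n : ℝ} (hn : 0 < n) {a b : ℝ} {f : Ω → ℕ}
    (hf : ∀ ω, n * Z ω + a ≤ f ω) (hf' : ∀ ω, (f ω : ℝ) ≤ n * Z ω + b) :
    n * distExp P h Z + a ≤ distExp P h (fun ω => (f ω : ℝ)) ∧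
      distExp P h (fun ω => (f ω : ℝ)) ≤ n * distExp P h Z + b := by
  have hbound : ∀ ω, -(n * M) ≤ n * Z ω ∧ n * Z ω ≤ n * M := fun ω => by
    obtain ⟨h1, h2⟩ := abs_le.1 (hZ ω)
    rw [← mul_neg]
    constructor <;> gcongr
  have ha := neg_abs_le a
  have ha' := le_abs_self a
  have hb := neg_abs_le b
  have hb' := le_abs_self b
  have hle : ∀ ω, |n * Z ω + a| ≤ n * M + |a| + |b| := fun ω => by
    have := hbound ω
    exact abs_le.2 ⟨by linarith, by linarith⟩
  have hle' : ∀ ω, |n * Z ω + b| ≤ n * M + |a| + |b| := fun ω => by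
    have := hbound ω
    exact abs_le.2 ⟨by linarith, by linarith⟩
  have hlef : ∀ ω, |(f ω : ℝ)| ≤ n * M + |a| + |b| := fun ω =>
    abs_le.2 ⟨(neg_le_of_abs_le (hle ω)).trans (hf ω), (hf' ω).trans (le_of_abs_le (hle' ω))⟩
  rw [← distExp_mul_add hdist hZ hn, ← distExp_mul_add hdist hZ hn]
  exact ⟨distExp_mono hdist hle hlef hf, distExp_mono hdist hlef hle' hf'⟩

end DistortedExpectation

section Additivity

variable {P : Measure Ω} [IsProbabilityMeasure P] {h : ℝ → ℝ} {X Y : Ω → ℝ}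

lemma le_of_forall_nat_mul_le {a b c : ℝ} (hab : ∀ n : ℕ, 0 < n → n * a ≤ n * b + c) :
    a ≤ b := by
  by_contra! hlt
  obtain ⟨n, hn⟩ := exists_nat_gt (c / (a - b))
  rw [div_lt_iff₀ (sub_pos.2 hlt)] at hn
  have h1 := hab (n + 1) n.succ_pos
  push_cast at h1
  nlinarith

lemma natCeil_mul_add_bounds {M n z : ℝ} (hz : |z| ≤ M) (hn : 0 ≤ n) :
    n * z + n * M ≤ (⌈n * (z + M)⌉₊ : ℝ) ∧ (⌈n * (z + M)⌉₊ : ℝ) ≤ n * z + (n * M + 1) := by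
  have h0 : 0 ≤ n * (z + M) := mul_nonneg hn (by linarith [(abs_le.1 hz).1])
  have h1 := Nat.le_ceil (n * (z + M))
  have h2 := Nat.ceil_lt_add_one h0
  constructor <;> linarith

lemma IsBddRV.exists_common_bound (hX : IsBddRV X) (hY : IsBddRV Y) :
    ∃ M : ℝ, (∀ ω, |X ω| ≤ M) ∧ (∀ ω, |Y ω| ≤ M) ∧ ∀ ω, |X ω + Y ω| ≤ M + M := by
  obtain ⟨-, M₁, h1⟩ := hX
  obtain ⟨-, M₂, h2⟩ := hY
  have h1' : ∀ ω, |X ω| ≤ max M₁ M₂ := fun ω => (h1 ω).trans (le_max_left _ _)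
  have h2' : ∀ ω, |Y ω| ≤ max M₁ M₂ := fun ω => (h2 ω).trans (le_max_right _ _)
  exact ⟨_, h1', h2', fun ω => (abs_add_le _ _).trans (add_le_add (h1' ω) (h2' ω))⟩

lemma natCeil_add_natCeil_lt {M n x y : ℝ} (hn : 0 ≤ n) (hx : |x| ≤ M) (hy : |y| ≤ M) :
    ⌈n * (x + M)⌉₊ + ⌈n * (y + M)⌉₊ < ⌈n * (2 * M)⌉₊ + ⌈n * (2 * M)⌉₊ + 1 := by
  have h1 : ⌈n * (x + M)⌉₊ ≤ ⌈n * (2 * M)⌉₊ :=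
    Nat.ceil_mono (mul_le_mul_of_nonneg_left (by linarith [(abs_le.1 hx).2]) hn)
  have h2 : ⌈n * (y + M)⌉₊ ≤ ⌈n * (2 * M)⌉₊ :=
    Nat.ceil_mono (mul_le_mul_of_nonneg_left (by linarith [(abs_le.1 hy).2]) hn)
  omega

/-- Superadditivity of the distorted expectation for convex distortions. -/
theorem distExp_add_le_of_convexOn (hdist : IsDistortion h) (hconv : ConvexOn ℝ (Icc 0 1) h)
    (hX : IsBddRV X) (hY : IsBddRV Y) :
    distExp P h X + distExp P h Y ≤ distExp P h (fun ω => X ω + Y ω) := by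
  obtain ⟨M, hXM, hYM, hXYM⟩ := hX.exists_common_bound hY
  refine le_of_forall_nat_mul_le (c := 2) fun n hn => ?_
  have hn' : (0 : ℝ) < n := Nat.cast_pos.2 hn
  set f : Ω → ℕ := fun ω => ⌈n * (X ω + M)⌉₊
  set g : Ω → ℕ := fun ω => ⌈n * (Y ω + M)⌉₊
  have hf := fun ω => natCeil_mul_add_bounds (hXM ω) hn'.le
  have hg := fun ω => natCeil_mul_add_bounds (hYM ω) hn'.le
  have hN := fun ω => natCeil_add_natCeil_lt hn'.le (hXM ω) (hYM ω)
  have key := sum_range_natChoquet_superadditive (P := P) hconv hdist.2.1 (f := f) (g := g)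
    (Nat.measurable_ceil.comp ((hX.1.add_const M).const_mul n))
    (Nat.measurable_ceil.comp ((hY.1.add_const M).const_mul n)) hN
  rw [← distExp_natCast hdist fun ω => (le_self_add.trans_lt (hN ω)).le,
    ← distExp_natCast hdist fun ω => (le_add_self.trans_lt (hN ω)).le,
    ← distExp_natCast hdist fun ω => (hN ω).le] at key
  have e1 := (distExp_natCast_mem_Icc (P := P) hdist hXM hn' (f := f) (fun ω => (hf ω).1)
    fun ω => (hf ω).2).1
  have e2 := (distExp_natCast_mem_Icc (P := P) hdist hYM hn' (f := g) (fun ω => (hg ω).1)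
    fun ω => (hg ω).2).1
  have e3 := (distExp_natCast_mem_Icc (P := P) hdist hXYM hn' (f := fun ω => f ω + g ω)
    (a := n * M + n * M) (b := n * M + 1 + (n * M + 1))
    (fun ω => by push_cast; linarith [(hf ω).1, (hg ω).1])
    fun ω => by push_cast; linarith [(hf ω).2, (hg ω).2]).2
  linarith

/-- Subadditivity of the distorted expectation for comonotonic variables, that is, variables whose
upper level sets are nested up to null sets. -/
theorem distExp_add_le_of_nested (hdist : IsDistortion h)
    (hX : IsBddRV X) (hY : IsBddRV Y)
    (hnest : ∀ x y : ℝ, P.real ({ω | x < X ω} \ {ω | y < Y ω}) = 0 ∨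
      P.real ({ω | y < Y ω} \ {ω | x < X ω}) = 0) :
    distExp P h (fun ω => X ω + Y ω) ≤ distExp P h X + distExp P h Y := by
  obtain ⟨M, hXM, hYM, hXYM⟩ := hX.exists_common_bound hY
  refine le_of_forall_nat_mul_le (c := 2) fun n hn => ?_
  have hn' : (0 : ℝ) < n := Nat.cast_pos.2 hn
  set f : Ω → ℕ := fun ω => ⌈n * (X ω + M)⌉₊
  set g : Ω → ℕ := fun ω => ⌈n * (Y ω + M)⌉₊
  have hf := fun ω => natCeil_mul_add_bounds (hXM ω) hn'.le
  have hg := fun ω => natCeil_mul_add_bounds (hYM ω) hn'.le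
  have hN := fun ω => natCeil_add_natCeil_lt hn'.le (hXM ω) (hYM ω)
  have hlevel (z : ℝ) (k : ℕ) : k < ⌈n * (z + M)⌉₊ ↔ k / n - M < z := by
    rw [Nat.lt_ceil, sub_lt_iff_lt_add, div_lt_iff₀' hn']
  have key := sum_range_natChoquet_comonotone (P := P) (h := h) hdist.2.1 (f := f) (g := g) hN
    fun i j => by simpa only [f, g, hlevel] using hnest (i / n - M) (j / n - M)
  rw [← distExp_natCast hdist fun ω => (le_self_add.trans_lt (hN ω)).le,
    ← distExp_natCast hdist fun ω => (le_add_self.trans_lt (hN ω)).le,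
    ← distExp_natCast hdist fun ω => (hN ω).le] at key
  have e1 := (distExp_natCast_mem_Icc (P := P) hdist hXM hn' (f := f) (fun ω => (hf ω).1)
    fun ω => (hf ω).2).2
  have e2 := (distExp_natCast_mem_Icc (P := P) hdist hYM hn' (f := g) (fun ω => (hg ω).1)
    fun ω => (hg ω).2).2
  have e3 := (distExp_natCast_mem_Icc (P := P) hdist hXYM hn' (f := fun ω => f ω + g ω)
    (a := n * M + n * M) (b := n * M + 1 + (n * M + 1))
    (fun ω => by push_cast; linarith [(hf ω).1, (hg ω).1])
    fun ω => by push_cast; linarith [(hf ω).2, (hg ω).2]).1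
  linarith

lemma HasCopula.nested {C : ℝ → ℝ → ℝ} (hXY : HasCopula P X Y C) (hX : Measurable X)
    (hY : Measurable Y) (hC : ∀ u ∈ Icc (0:ℝ) 1, ∀ v ∈ Icc (0:ℝ) 1, C u v = min u v) (x y : ℝ) :
    P.real ({ω | x < X ω} \ {ω | y < Y ω}) = 0 ∨ P.real ({ω | y < Y ω} \ {ω | x < X ω}) = 0 := by
  set A : Set Ω := {ω | X ω ≤ x}
  set B : Set Ω := {ω | Y ω ≤ y}
  have hA : MeasurableSet A := measurableSet_le hX measurable_const
  have hB : MeasurableSet B := measurableSet_le hY measurable_const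
  have hmin : P.real (A ∩ B) = min (P.real A) (P.real B) :=
    (hXY x y).trans (hC _ ⟨measureReal_nonneg, measureReal_le_one⟩ _
      ⟨measureReal_nonneg, measureReal_le_one⟩)
  have e1 : {ω | x < X ω} \ {ω | y < Y ω} = B \ A := by
    ext ω
    change x < X ω ∧ ¬ y < Y ω ↔ Y ω ≤ y ∧ ¬ X ω ≤ x
    rw [not_lt, not_le, and_comm]
  have e2 : {ω | y < Y ω} \ {ω | x < X ω} = A \ B := by
    ext ω
    change y < Y ω ∧ ¬ x < X ω ↔ X ω ≤ x ∧ ¬ Y ω ≤ y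
    rw [not_lt, not_le, and_comm]
  have h1 := measureReal_sdiff_add_inter (μ := P) (s := B) hA
  have h2 := measureReal_sdiff_add_inter (μ := P) (s := A) hB
  rw [inter_comm] at h1
  rw [e1, e2]
  rcases min_choice (P.real A) (P.real B) with hm | hm
  · right
    linarith
  · left
    linarith

end Additivity

section TwoPoint

variable {P : Measure Ω} [IsProbabilityMeasure P] {h : ℝ → ℝ} {A B : Set Ω} {C : ℝ → ℝ → ℝ}

lemma IsCopula.le_left (hC : IsCopula C) {u v : ℝ} (hu : u ∈ Icc (0:ℝ) 1)
    (hv : v ∈ Icc (0:ℝ) 1) : C u v ≤ u := by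
  have h1 := hC.2 0 u v 1 ⟨le_rfl, zero_le_one⟩ hu hv ⟨zero_le_one, le_rfl⟩ hu.1 hv.2
  have h2 := hC.1 u hu
  have h3 := hC.1 v hv
  have h4 := hC.1 1 ⟨zero_le_one, le_rfl⟩
  linarith

lemma IsCopula.le_right (hC : IsCopula C) {u v : ℝ} (hu : u ∈ Icc (0:ℝ) 1)
    (hv : v ∈ Icc (0:ℝ) 1) : C u v ≤ v := by
  have h1 := hC.2 u 1 0 v hu ⟨zero_le_one, le_rfl⟩ ⟨le_rfl, zero_le_one⟩ hv hu.2 hv.1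
  have h2 := hC.1 u hu
  have h3 := hC.1 v hv
  have h4 := hC.1 1 ⟨zero_le_one, le_rfl⟩
  linarith

lemma IsCopula.nonneg (hC : IsCopula C) {u v : ℝ} (hu : u ∈ Icc (0:ℝ) 1)
    (hv : v ∈ Icc (0:ℝ) 1) : 0 ≤ C u v := by
  have h0 : (0 : ℝ) ∈ Icc (0:ℝ) 1 := ⟨le_rfl, zero_le_one⟩
  have h1 := hC.2 0 u 0 v h0 hu h0 hv hu.1 hv.1
  have h2 := hC.1 u hu
  have h3 := hC.1 v hv
  have h4 := hC.1 0 h0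
  linarith

lemma IsCopula.add_sub_one_le (hC : IsCopula C) {u v : ℝ} (hu : u ∈ Icc (0:ℝ) 1)
    (hv : v ∈ Icc (0:ℝ) 1) : u + v - 1 ≤ C u v := by
  have h0 : (1 : ℝ) ∈ Icc (0:ℝ) 1 := ⟨zero_le_one, le_rfl⟩
  have h1 := hC.2 u 1 v 1 hu h0 hv h0 hu.2 hv.2
  have h2 := hC.1 u hu
  have h3 := hC.1 v hv
  have h4 := hC.1 1 h0
  linarith

open Classical in
lemma setOf_ite_le {Ω : Type*} (A : Set Ω) (x : ℝ) :
    {ω | ((if ω ∈ A then 0 else 1 : ℕ) : ℝ) ≤ x} =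
      if x < 0 then ∅ else if x < 1 then A else univ := by
  ext ω
  by_cases hω : ω ∈ A <;> split_ifs with h1 h2 <;> simp [hω] <;> linarith

open Classical in
lemma isBddRV_ite (hA : MeasurableSet A) :
    IsBddRV fun ω => ((if ω ∈ A then 0 else 1 : ℕ) : ℝ) :=
  ⟨measurable_from_top.comp (Measurable.ite hA measurable_const measurable_const), 1, fun ω => by
    by_cases hω : ω ∈ A <;> simp [hω]⟩

open Classical in
lemma hasCopula_ite (hC : IsCopula C) (hAB : P.real (A ∩ B) = C (P.real A) (P.real B)) :
    HasCopula P (fun ω => ((if ω ∈ A then 0 else 1 : ℕ) : ℝ))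
      (fun ω => ((if ω ∈ B then 0 else 1 : ℕ) : ℝ)) C := by
  intro x y
  change P.real ({ω | ((if ω ∈ A then 0 else 1 : ℕ) : ℝ) ≤ x} ∩
    {ω | ((if ω ∈ B then 0 else 1 : ℕ) : ℝ) ≤ y}) = C (P.real _) (P.real _)
  have hA := hC.1 _ ⟨measureReal_nonneg (μ := P) (s := A), measureReal_le_one⟩
  have hB := hC.1 _ ⟨measureReal_nonneg (μ := P) (s := B), measureReal_le_one⟩
  have h0 := hC.1 0 ⟨le_rfl, zero_le_one⟩
  have h1 := hC.1 1 ⟨zero_le_one, le_rfl⟩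
  rw [setOf_ite_le, setOf_ite_le]
  split_ifs <;> simp [hA, hB, h0, h1, hAB]

open Classical in
lemma identDistrib_ite (hA : MeasurableSet A) (hB : MeasurableSet B)
    (hAB : P.real A = P.real B) :
    IdentDistrib (fun ω => ((if ω ∈ A then 0 else 1 : ℕ) : ℝ))
      (fun ω => ((if ω ∈ B then 0 else 1 : ℕ) : ℝ)) P P where
  aemeasurable_fst := (isBddRV_ite hA).1.aemeasurable
  aemeasurable_snd := (isBddRV_ite hB).1.aemeasurable
  map_eq := by
    have := Measure.isProbabilityMeasure_map (isBddRV_ite hA).1.aemeasurable (μ := P)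
    refine Measure.ext_of_Iic _ _ fun x => ?_
    rw [Measure.map_apply (isBddRV_ite hA).1 measurableSet_Iic,
      Measure.map_apply (isBddRV_ite hB).1 measurableSet_Iic]
    change P {ω | ((if ω ∈ A then 0 else 1 : ℕ) : ℝ) ≤ x} =
      P {ω | ((if ω ∈ B then 0 else 1 : ℕ) : ℝ) ≤ x}
    rw [setOf_ite_le, setOf_ite_le]
    split_ifs
    · rfl
    · exact (measureReal_eq_measureReal_iff).1 hAB
    · rfl

open Classical in
lemma distExp_ite_add_ite (hdist : IsDistortion h) (hA : MeasurableSet A)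
    (hB : MeasurableSet B) :
    distExp P h (fun ω => ((if ω ∈ A then 0 else 1 : ℕ) : ℝ) +
      ((if ω ∈ B then 0 else 1 : ℕ) : ℝ)) =
      h (1 - P.real (A ∩ B)) + h (1 - P.real A - P.real B + P.real (A ∩ B)) := by
  have key := distExp_natCast (P := P) hdist (N := 2)
    (f := fun ω => (if ω ∈ A then 0 else 1) + (if ω ∈ B then 0 else 1))
    fun ω => by split_ifs <;> simp
  simp only [Nat.cast_add] at key
  rw [key, Finset.sum_range_succ, Finset.sum_range_one]
  have e0 : {ω | 0 < (if ω ∈ A then 0 else 1) + (if ω ∈ B then 0 else 1)} = (A ∩ B)ᶜ := by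
    ext ω
    by_cases h1 : ω ∈ A <;> by_cases h2 : ω ∈ B <;> simp [h1, h2]
  have e1 : {ω | 1 < (if ω ∈ A then 0 else 1) + (if ω ∈ B then 0 else 1)} = (A ∪ B)ᶜ := by
    ext ω
    by_cases h1 : ω ∈ A <;> by_cases h2 : ω ∈ B <;> simp [h1, h2]
  have hadd := measureReal_union_add_inter (μ := P) (s := A) hB
  rw [e0, e1, probReal_compl_eq_one_sub (hA.inter hB), probReal_compl_eq_one_sub (hA.union hB)]
  congr 2
  linarith

end TwoPoint

/-- For a strictly convex distortion function h, a copula C is universally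
optimal for h with linear cost iff C = C⁺, the comonotonic copula. -/
theorem univOptimal_iff_comonotonic_of_strictConvex
    (P : Measure Ω) [IsProbabilityMeasure P] (hP : AtomlessProb P)
    (h : ℝ → ℝ) (hdist : IsDistortion h) (hconv : StrictConvexOn ℝ (Icc 0 1) h)
    (C : ℝ → ℝ → ℝ) (hC : IsCopula C) :
    UnivOptimal P h C ↔ ∀ u ∈ Icc (0:ℝ) 1, ∀ v ∈ Icc (0:ℝ) 1, C u v = min u v := by
  constructor
  · intro hopt u hu v hv
    by_contra hne
    have hlt : C u v < min u v :=
      lt_of_le_of_ne (le_min (hC.le_left hu hv) (hC.le_right hu hv)) hne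
    obtain ⟨A, B, hA, hB, hAu, hBv, hAB⟩ := hP.exists_pair (hC.nonneg hu hv)
      (hC.le_left hu hv) (hC.le_right hu hv) hu.2 (hC.add_sub_one_le hu hv)
    obtain ⟨A', B', hA', hB', hAu', hBv', hAB'⟩ := hP.exists_pair (le_min hu.1 hv.1)
      (min_le_left u v) (min_le_right u v) hu.2
      (le_min (by linarith [hv.2]) (by linarith [hu.2]))
    have hle := hopt _ _ _ _ (isBddRV_ite hA) (isBddRV_ite hB) (isBddRV_ite hA')
      (isBddRV_ite hB') (hasCopula_ite hC (by rw [hAB, hAu, hBv]))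
      (identDistrib_ite hA hA' (hAu.trans hAu'.symm))
      (identDistrib_ite hB hB' (hBv.trans hBv'.symm))
    rw [distExp_ite_add_ite hdist hA hB, distExp_ite_add_ite hdist hA' hB', hAu, hBv, hAB,
      hAu', hBv', hAB'] at hle
    have h0 := hC.nonneg hu hv
    have h1 := hC.add_sub_one_le hu hv
    have hmin : u + v - 1 ≤ min u v := le_min (by linarith [hv.2]) (by linarith [hu.2])
    have hmm := min_add_max u v
    have hmax : min u v ≤ max u v := min_le_max
    have hmax1 : max u v ≤ 1 := max_le hu.2 hv.2
    have := hconv.add_lt_add_of_add_eq (p := 1 - u - v + C u v) (q := 1 - C u v)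
      (x := 1 - min u v) (y := 1 - u - v + min u v) ⟨by linarith, by linarith⟩
      ⟨by linarith, by linarith⟩ (by linarith) (by linarith) (by ring)
    linarith
  · intro hmin X Y X' Y' hX hY hX' hY' hXY hXX' hYY'
    calc distExp P h (fun ω => X ω + Y ω) ≤ distExp P h X + distExp P h Y :=
          distExp_add_le_of_nested hdist hX hY (hXY.nested hX.1 hY.1 hmin)
      _ = distExp P h X' + distExp P h Y' := by
          rw [distExp_congr_identDistrib hXX', distExp_congr_identDistrib hYY']
      _ ≤ distExp P h (fun ω => X' ω + Y' ω) :=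
          distExp_add_le_of_convexOn hdist hconv.convexOn hX' hY'
end
end

section
/- Symmetry between minimization and maximization: Let h be a distortion function with dual h̃(t) = 1 − h(1−t), and let p∈(0,1). Then the copula C^±_p is universally optimal for h with linear cost if and only if the copula C^∓_{1−p} is universally maximal for h̃ with linear cost. The same equivalence holds with optimality restricted to couplings whose copula lies in 𝒞_p = {C : C(1−p,1−p)=1−p} and maximality restricted to couplings whose copula lies in 𝒞_{1−p}. -/
open MeasureTheory Set ProbabilityTheory

noncomputable section

variable {Ω : Type*} [MeasurableSpace Ω]

open Filter Topology

/-- The survival copula of `C`. -/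
def survivalCopula (C : ℝ → ℝ → ℝ) (u v : ℝ) : ℝ :=
  u + v - 1 + C (1 - u) (1 - v)

theorem one_sub_mem_unit {u : ℝ} (hu : u ∈ Icc (0:ℝ) 1) : 1 - u ∈ Icc (0:ℝ) 1 :=
  ⟨by linarith [hu.2], by linarith [hu.1]⟩

theorem IsCopula.survival {C : ℝ → ℝ → ℝ} (hC : IsCopula C) : IsCopula (survivalCopula C) := by
  obtain ⟨hb, hi⟩ := hC
  refine ⟨fun u hu => ?_, fun u₁ u₂ v₁ v₂ hu₁ hu₂ hv₁ hv₂ hu hv => ?_⟩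
  · obtain ⟨h1, h2, h3, h4⟩ := hb (1 - u) (one_sub_mem_unit hu)
    simp only [survivalCopula, sub_zero, sub_self, h1, h2, h3, h4]
    refine ⟨?_, ?_, ?_, ?_⟩ <;> ring
  · have := hi (1 - u₂) (1 - u₁) (1 - v₂) (1 - v₁) (one_sub_mem_unit hu₂) (one_sub_mem_unit hu₁)
      (one_sub_mem_unit hv₂) (one_sub_mem_unit hv₁) (by linarith) (by linarith)
    simp only [survivalCopula]
    linarith

theorem survivalCopula_mem_copulaSet {p q : ℝ} (hpq : p + q = 1) {C : ℝ → ℝ → ℝ}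
    (hC : C ∈ copulaSet p) : survivalCopula C ∈ copulaSet q := by
  refine ⟨hC.1.survival, ?_⟩
  have h := hC.2
  obtain rfl : q = 1 - p := by linarith
  simp only [survivalCopula]
  rw [show 1 - (1 - (1 - p)) = 1 - p by ring, h]
  ring

theorem IsCopula.sub_left_mem_bounds {C : ℝ → ℝ → ℝ} (hC : IsCopula C) {u₁ u₂ v : ℝ}
    (hu₁ : u₁ ∈ Icc (0:ℝ) 1) (hu₂ : u₂ ∈ Icc (0:ℝ) 1) (hv : v ∈ Icc (0:ℝ) 1) (hu : u₁ ≤ u₂) :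
    0 ≤ C u₂ v - C u₁ v ∧ C u₂ v - C u₁ v ≤ u₂ - u₁ := by
  have h1 := hC.2 u₁ u₂ 0 v hu₁ hu₂ (by simp) hv hu hv.1
  have h2 := hC.2 u₁ u₂ v 1 hu₁ hu₂ hv (by simp) hu hv.2
  obtain ⟨a1, -, b1, -⟩ := hC.1 u₁ hu₁
  obtain ⟨a2, -, b2, -⟩ := hC.1 u₂ hu₂
  constructor <;> linarith

theorem IsCopula.sub_right_mem_bounds {C : ℝ → ℝ → ℝ} (hC : IsCopula C) {u v₁ v₂ : ℝ}
    (hu : u ∈ Icc (0:ℝ) 1) (hv₁ : v₁ ∈ Icc (0:ℝ) 1) (hv₂ : v₂ ∈ Icc (0:ℝ) 1) (hv : v₁ ≤ v₂) :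
    0 ≤ C u v₂ - C u v₁ ∧ C u v₂ - C u v₁ ≤ v₂ - v₁ := by
  have h1 := hC.2 0 u v₁ v₂ (by simp) hu hv₁ hv₂ hu.1 hv
  have h2 := hC.2 u 1 v₁ v₂ hu (by simp) hv₁ hv₂ hu.2 hv
  obtain ⟨-, a1, -, b1⟩ := hC.1 v₁ hv₁
  obtain ⟨-, a2, -, b2⟩ := hC.1 v₂ hv₂
  constructor <;> linarith

/-- A copula is 1-Lipschitz with respect to the `ℓ¹` distance on the unit square. -/
theorem IsCopula.abs_sub_le {C : ℝ → ℝ → ℝ} (hC : IsCopula C) {u₁ u₂ v₁ v₂ : ℝ}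
    (hu₁ : u₁ ∈ Icc (0:ℝ) 1) (hu₂ : u₂ ∈ Icc (0:ℝ) 1)
    (hv₁ : v₁ ∈ Icc (0:ℝ) 1) (hv₂ : v₂ ∈ Icc (0:ℝ) 1) :
    |C u₁ v₁ - C u₂ v₂| ≤ |u₁ - u₂| + |v₁ - v₂| := by
  have hl : |C u₁ v₁ - C u₂ v₁| ≤ |u₁ - u₂| := by
    rcases le_total u₁ u₂ with hu | hu
    · obtain ⟨h1, h2⟩ := hC.sub_left_mem_bounds hu₁ hu₂ hv₁ hu
      rw [abs_sub_comm, abs_sub_comm u₁, abs_of_nonneg h1, abs_of_nonneg (by linarith)]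
      exact h2
    · obtain ⟨h1, h2⟩ := hC.sub_left_mem_bounds hu₂ hu₁ hv₁ hu
      rw [abs_of_nonneg h1, abs_of_nonneg (by linarith)]
      exact h2
  have hr : |C u₂ v₁ - C u₂ v₂| ≤ |v₁ - v₂| := by
    rcases le_total v₁ v₂ with hv | hv
    · obtain ⟨h1, h2⟩ := hC.sub_right_mem_bounds hu₂ hv₁ hv₂ hv
      rw [abs_sub_comm, abs_sub_comm v₁, abs_of_nonneg h1, abs_of_nonneg (by linarith)]
      exact h2
    · obtain ⟨h1, h2⟩ := hC.sub_right_mem_bounds hu₂ hv₂ hv₁ hv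
      rw [abs_of_nonneg h1, abs_of_nonneg (by linarith)]
      exact h2
  exact (_root_.abs_sub_le _ (C u₂ v₁) _).trans (add_le_add hl hr)

theorem IsCopula.continuousOn {C : ℝ → ℝ → ℝ} (hC : IsCopula C) :
    ContinuousOn (fun q : ℝ × ℝ => C q.1 q.2) (Icc 0 1 ×ˢ Icc 0 1) := by
  intro q hq
  rw [ContinuousWithinAt, tendsto_iff_dist_tendsto_zero]
  have hlim : Tendsto (fun r : ℝ × ℝ => |r.1 - q.1| + |r.2 - q.2|)
      (𝓝[Icc 0 1 ×ˢ Icc 0 1] q) (𝓝 0) := by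
    have hc : Continuous (fun r : ℝ × ℝ => |r.1 - q.1| + |r.2 - q.2|) := by fun_prop
    simpa using (hc.tendsto q).mono_left nhdsWithin_le_nhds
  refine squeeze_zero' (Eventually.of_forall fun _ => dist_nonneg) ?_ hlim
  filter_upwards [self_mem_nhdsWithin] with r hr
  exact hC.abs_sub_le hr.1 hq.1 hr.2 hq.2

theorem Cpm_eq_max {p u v : ℝ} (hu : u ∈ Icc (0:ℝ) 1) (hv : v ∈ Icc (0:ℝ) 1) :
    Cpm p u v = max (min (min u v) (1 - p)) (u + v - 1) := by
  obtain ⟨hu0, hu1⟩ := hu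
  obtain ⟨hv0, hv1⟩ := hv
  unfold Cpm
  grind

theorem Cmp_eq_survival_Cpm {p u v : ℝ} (hu : u ∈ Icc (0:ℝ) 1) (hv : v ∈ Icc (0:ℝ) 1) :
    Cmp (1 - p) u v = survivalCopula (Cpm p) u v := by
  obtain ⟨hu0, hu1⟩ := hu
  obtain ⟨hv0, hv1⟩ := hv
  unfold Cmp survivalCopula Cpm
  grind

theorem Cpm_eq_survival_Cmp {p u v : ℝ} (hu : u ∈ Icc (0:ℝ) 1) (hv : v ∈ Icc (0:ℝ) 1) :
    Cpm p u v = survivalCopula (Cmp (1 - p)) u v := by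
  rw [survivalCopula, Cmp_eq_survival_Cpm (one_sub_mem_unit hu) (one_sub_mem_unit hv),
    survivalCopula, sub_sub_cancel, sub_sub_cancel]
  ring

theorem continuousOn_Cpm (p : ℝ) :
    ContinuousOn (fun q : ℝ × ℝ => Cpm p q.1 q.2) (Icc 0 1 ×ˢ Icc 0 1) := by
  have hc : Continuous (fun q : ℝ × ℝ => max (min (min q.1 q.2) (1 - p)) (q.1 + q.2 - 1)) := by
    fun_prop
  exact hc.continuousOn.congr fun q hq => Cpm_eq_max hq.1 hq.2

theorem continuousOn_survivalCopula {C : ℝ → ℝ → ℝ}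
    (hC : ContinuousOn (fun q : ℝ × ℝ => C q.1 q.2) (Icc 0 1 ×ˢ Icc 0 1)) :
    ContinuousOn (fun q : ℝ × ℝ => survivalCopula C q.1 q.2) (Icc 0 1 ×ˢ Icc 0 1) := by
  have hr : ContinuousOn (fun q : ℝ × ℝ => (1 - q.1, 1 - q.2)) (Icc 0 1 ×ˢ Icc 0 1) := by
    fun_prop
  have hl : ContinuousOn (fun q : ℝ × ℝ => q.1 + q.2 - 1) (Icc 0 1 ×ˢ Icc 0 1) := by
    fun_prop
  exact hl.add (hC.comp hr fun q hq => ⟨one_sub_mem_unit hq.1, one_sub_mem_unit hq.2⟩)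

theorem continuousOn_Cmp (p : ℝ) :
    ContinuousOn (fun q : ℝ × ℝ => Cmp (1 - p) q.1 q.2) (Icc 0 1 ×ˢ Icc 0 1) :=
  (continuousOn_survivalCopula (continuousOn_Cpm p)).congr
    fun _ hq => Cmp_eq_survival_Cpm hq.1 hq.2

theorem toReal_measure_mem_unit (P : Measure Ω) [IsProbabilityMeasure P] (s : Set Ω) :
    (P s).toReal ∈ Icc (0:ℝ) 1 :=
  ⟨measureReal_nonneg, measureReal_le_one⟩

theorem HasCopula.congr {P : Measure Ω} [IsProbabilityMeasure P] {X Y : Ω → ℝ} {C D : ℝ → ℝ → ℝ}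
    (h : HasCopula P X Y C)
    (hCD : ∀ u ∈ Icc (0:ℝ) 1, ∀ v ∈ Icc (0:ℝ) 1, D u v = C u v) : HasCopula P X Y D :=
  fun x y => (h x y).trans
    (hCD _ (toReal_measure_mem_unit P _) _ (toReal_measure_mem_unit P _)).symm

theorem lt_iff_exists_le_sub_one_div {a b : ℝ} : a < b ↔ ∃ n : ℕ, a ≤ b - 1 / ((n : ℝ) + 1) := by
  constructor
  · intro h
    obtain ⟨n, hn⟩ := exists_nat_one_div_lt (sub_pos.2 h)
    exact ⟨n, by linarith⟩
  · rintro ⟨n, hn⟩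
    have : 0 < 1 / ((n : ℝ) + 1) := Nat.one_div_pos_of_nat
    linarith

theorem sub_one_div_le_of_le {n m : ℕ} (h : n ≤ m) (a : ℝ) :
    a - 1 / ((n : ℝ) + 1) ≤ a - 1 / ((m : ℝ) + 1) :=
  sub_le_sub_left (Nat.one_div_le_one_div h) a

theorem tendsto_measure_le_sub (P : Measure Ω) [IsProbabilityMeasure P] (X : Ω → ℝ) (a : ℝ) :
    Tendsto (fun n : ℕ => (P {ω | X ω ≤ a - 1 / ((n : ℝ) + 1)}).toReal) atTop
      (𝓝 (P {ω | X ω < a}).toReal) := by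
  have hm : Monotone fun n : ℕ => {ω | X ω ≤ a - 1 / ((n : ℝ) + 1)} :=
    fun n m hnm ω hω => le_trans hω (sub_one_div_le_of_le hnm a)
  have hU : {ω | X ω < a} = ⋃ n : ℕ, {ω | X ω ≤ a - 1 / ((n : ℝ) + 1)} := by
    ext ω
    simpa using lt_iff_exists_le_sub_one_div
  rw [hU]
  exact (ENNReal.tendsto_toReal (measure_ne_top P _)).comp (tendsto_measure_iUnion_atTop hm)

theorem tendsto_measure_le_sub_and (P : Measure Ω) [IsProbabilityMeasure P] (X Y : Ω → ℝ)
    (a b : ℝ) :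
    Tendsto (fun n : ℕ =>
        (P {ω | X ω ≤ a - 1 / ((n : ℝ) + 1) ∧ Y ω ≤ b - 1 / ((n : ℝ) + 1)}).toReal) atTop
      (𝓝 (P {ω | X ω < a ∧ Y ω < b}).toReal) := by
  have hm : Monotone fun n : ℕ =>
      {ω | X ω ≤ a - 1 / ((n : ℝ) + 1) ∧ Y ω ≤ b - 1 / ((n : ℝ) + 1)} :=
    fun n m hnm ω hω => ⟨hω.1.trans (sub_one_div_le_of_le hnm a),
      hω.2.trans (sub_one_div_le_of_le hnm b)⟩
  have hU : {ω | X ω < a ∧ Y ω < b} =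
      ⋃ n : ℕ, {ω | X ω ≤ a - 1 / ((n : ℝ) + 1) ∧ Y ω ≤ b - 1 / ((n : ℝ) + 1)} := by
    ext ω
    simp only [mem_ofPred_eq, mem_iUnion]
    constructor
    · rintro ⟨hx, hy⟩
      obtain ⟨n, hn⟩ := lt_iff_exists_le_sub_one_div.1 hx
      obtain ⟨m, hm⟩ := lt_iff_exists_le_sub_one_div.1 hy
      exact ⟨max n m, hn.trans (sub_one_div_le_of_le (le_max_left n m) a),
        hm.trans (sub_one_div_le_of_le (le_max_right n m) b)⟩
    · rintro ⟨n, hx, hy⟩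
      exact ⟨lt_iff_exists_le_sub_one_div.2 ⟨n, hx⟩, lt_iff_exists_le_sub_one_div.2 ⟨n, hy⟩⟩
  rw [hU]
  exact (ENNReal.tendsto_toReal (measure_ne_top P _)).comp (tendsto_measure_iUnion_atTop hm)

/-- A continuous copula also links the left limits of the distribution functions. -/
theorem HasCopula.measure_lt {P : Measure Ω} [IsProbabilityMeasure P] {X Y : Ω → ℝ}
    {C : ℝ → ℝ → ℝ} (h : HasCopula P X Y C)
    (hC : ContinuousOn (fun q : ℝ × ℝ => C q.1 q.2) (Icc 0 1 ×ˢ Icc 0 1)) (a b : ℝ) :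
    (P {ω | X ω < a ∧ Y ω < b}).toReal = C (P {ω | X ω < a}).toReal (P {ω | Y ω < b}).toReal := by
  refine tendsto_nhds_unique (tendsto_measure_le_sub_and P X Y a b) ?_
  simp only [h _ _]
  have hcont := hC ((P {ω | X ω < a}).toReal, (P {ω | Y ω < b}).toReal)
    ⟨toReal_measure_mem_unit P _, toReal_measure_mem_unit P _⟩
  have hpair := (tendsto_measure_le_sub P X a).prodMk_nhds (tendsto_measure_le_sub P Y b)
  exact hcont.tendsto.comp (tendsto_nhdsWithin_iff.2 ⟨hpair, Eventually.of_forall fun n =>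
    ⟨toReal_measure_mem_unit P _, toReal_measure_mem_unit P _⟩⟩)

theorem toReal_measure_neg_le (P : Measure Ω) [IsProbabilityMeasure P] {X : Ω → ℝ}
    (hX : Measurable X) (x : ℝ) :
    (P {ω | -X ω ≤ x}).toReal = 1 - (P {ω | X ω < -x}).toReal := by
  have hs : MeasurableSet {ω | X ω < -x} := measurableSet_lt hX measurable_const
  have hset : {ω | -X ω ≤ x} = {ω | X ω < -x}ᶜ := by
    ext ω
    simp [neg_le]
  rw [hset]
  exact probReal_compl_eq_one_sub hs

theorem HasCopula.neg {P : Measure Ω} [IsProbabilityMeasure P] {X Y : Ω → ℝ}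
    {C : ℝ → ℝ → ℝ} (h : HasCopula P X Y C) (hX : Measurable X) (hY : Measurable Y)
    (hC : ContinuousOn (fun q : ℝ × ℝ => C q.1 q.2) (Icc 0 1 ×ˢ Icc 0 1)) :
    HasCopula P (fun ω => -X ω) (fun ω => -Y ω) (survivalCopula C) := by
  intro x y
  have hsX : MeasurableSet {ω | X ω < -x} := measurableSet_lt hX measurable_const
  have hsY : MeasurableSet {ω | Y ω < -y} := measurableSet_lt hY measurable_const
  have hset : {ω | -X ω ≤ x ∧ -Y ω ≤ y} = ({ω | X ω < -x} ∪ {ω | Y ω < -y})ᶜ := by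
    ext ω
    simp [neg_le]
  have hjoint : (P {ω | -X ω ≤ x ∧ -Y ω ≤ y}).toReal =
      1 - P.real ({ω | X ω < -x} ∪ {ω | Y ω < -y}) := by
    rw [hset]
    exact probReal_compl_eq_one_sub (hsX.union hsY)
  have hincl := measureReal_union_add_inter (μ := P) (s := {ω | X ω < -x}) hsY
  have hlt : P.real ({ω | X ω < -x} ∩ {ω | Y ω < -y}) = _ := h.measure_lt hC (-x) (-y)
  rw [hjoint, toReal_measure_neg_le P hX, toReal_measure_neg_le P hY, survivalCopula,
    sub_sub_cancel, sub_sub_cancel, ← hlt]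
  simp only [Measure.real] at hincl ⊢
  linarith

theorem IsBddRV.neg {X : Ω → ℝ} (hX : IsBddRV X) : IsBddRV (fun ω => -X ω) :=
  ⟨hX.1.neg, hX.2.imp fun _ hM ω => by simpa using hM ω⟩

theorem ae_measure_lt_eq_measure_le (P : Measure Ω) [IsProbabilityMeasure P] {Z : Ω → ℝ}
    (hZ : Measurable Z) : ∀ᵐ x : ℝ, P {ω | x ≤ Z ω} = P {ω | Z ω > x} := by
  filter_upwards [(Measure.countable_meas_level_set_pos (μ := P) hZ).ae_notMem volume] with x hx
  have hzero : P {ω | Z ω = x} = 0 := by simpa using hx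
  refine le_antisymm ?_ (measure_mono fun ω (hω : x < Z ω) => hω.le)
  have hsub : {ω | x ≤ Z ω} ⊆ {ω | Z ω > x} ∪ {ω | Z ω = x} := by
    intro ω hω
    rcases (show x ≤ Z ω from hω).lt_or_eq with hlt | heq
    · exact Or.inl hlt
    · exact Or.inr heq.symm
  calc P {ω | x ≤ Z ω} ≤ P ({ω | Z ω > x} ∪ {ω | Z ω = x}) := measure_mono hsub
    _ ≤ P {ω | Z ω > x} + P {ω | Z ω = x} := measure_union_le _ _
    _ = P {ω | Z ω > x} := by rw [hzero, add_zero]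

theorem toReal_measure_neg_gt (P : Measure Ω) [IsProbabilityMeasure P] {Z : Ω → ℝ}
    (hZ : Measurable Z) (x : ℝ) :
    1 - (P {ω | -Z ω > x}).toReal = (P {ω | -x ≤ Z ω}).toReal := by
  have hs : MeasurableSet {ω | -Z ω > x} := measurableSet_lt measurable_const hZ.neg
  have hset : {ω | -x ≤ Z ω} = {ω | -Z ω > x}ᶜ := by
    ext ω
    simp [neg_le]
  rw [hset]
  exact (probReal_compl_eq_one_sub hs).symm

theorem distExp_dual_neg (P : Measure Ω) [IsProbabilityMeasure P] (h : ℝ → ℝ) {Z : Ω → ℝ}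
    (hZ : Measurable Z) :
    distExp P (fun t => 1 - h (1 - t)) (fun ω => -Z ω) = -distExp P h Z := by
  have hae := ae_measure_lt_eq_measure_le P hZ
  have hpos : ∫ x in Ioi (0:ℝ), (1 - h (P {ω | -x ≤ Z ω}).toReal) =
      -∫ x in Iio (0:ℝ), (h (P {ω | Z ω > x}).toReal - 1) := by
    rw [integral_comp_neg_Ioi 0 (fun x => 1 - h (P {ω | x ≤ Z ω}).toReal), neg_zero,
      integral_Iic_eq_integral_Iio, ← integral_neg]
    refine integral_congr_ae (ae_restrict_of_ae ?_)
    filter_upwards [hae] with x hx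
    rw [hx, neg_sub]
  have hneg : ∫ x in Iio (0:ℝ), (1 - h (P {ω | -x ≤ Z ω}).toReal - 1) =
      -∫ x in Ioi (0:ℝ), h (P {ω | Z ω > x}).toReal := by
    rw [← integral_Iic_eq_integral_Iio,
      integral_comp_neg_Iic 0 (fun x => 1 - h (P {ω | x ≤ Z ω}).toReal - 1), neg_zero,
      ← integral_neg]
    refine integral_congr_ae (ae_restrict_of_ae ?_)
    filter_upwards [hae] with x hx
    rw [hx]
    ring
  simp only [distExp, toReal_measure_neg_gt P hZ]
  rw [hpos, hneg]
  ring

theorem distExp_dual_neg_add_neg (P : Measure Ω) [IsProbabilityMeasure P] (h : ℝ → ℝ)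
    {X Y : Ω → ℝ} (hX : Measurable X) (hY : Measurable Y) :
    distExp P (fun t => 1 - h (1 - t)) (fun ω => -X ω + -Y ω) =
      -distExp P h (fun ω => X ω + Y ω) := by
  have hneg := distExp_dual_neg P h (hX.add hY)
  simpa only [Pi.add_def, neg_add] using hneg

theorem distExp_dual_add (P : Measure Ω) [IsProbabilityMeasure P] (h : ℝ → ℝ)
    {X Y : Ω → ℝ} (hX : Measurable X) (hY : Measurable Y) :
    distExp P (fun t => 1 - h (1 - t)) (fun ω => X ω + Y ω) =
      -distExp P h (fun ω => -X ω + -Y ω) := by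
  have hneg := distExp_dual_neg_add_neg P h hX.neg hY.neg
  simpa only [Pi.neg_apply, neg_neg] using hneg

section Duality

variable {P : Measure Ω} [IsProbabilityMeasure P] {h : ℝ → ℝ} {C D : ℝ → ℝ → ℝ}
  {𝒞 𝒟 : Set (ℝ → ℝ → ℝ)}

theorem UnivOptimal.univMaximal_dual (hopt : UnivOptimal P h C)
    (hD : ContinuousOn (fun q : ℝ × ℝ => D q.1 q.2) (Icc 0 1 ×ˢ Icc 0 1))
    (hCD : ∀ u ∈ Icc (0:ℝ) 1, ∀ v ∈ Icc (0:ℝ) 1, C u v = survivalCopula D u v) :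
    UnivMaximal P (fun t => 1 - h (1 - t)) D := by
  intro X Y X' Y' hX hY hX' hY' hXY hXX' hYY'
  rw [distExp_dual_add P h hX.1 hY.1, distExp_dual_add P h hX'.1 hY'.1]
  exact neg_le_neg (hopt _ _ _ _ hX.neg hY.neg hX'.neg hY'.neg
    ((hXY.neg hX.1 hY.1 hD).congr hCD) (hXX'.comp measurable_neg) (hYY'.comp measurable_neg))

theorem UnivMaximal.univOptimal_of_dual (hmax : UnivMaximal P (fun t => 1 - h (1 - t)) D)
    (hC : ContinuousOn (fun q : ℝ × ℝ => C q.1 q.2) (Icc 0 1 ×ˢ Icc 0 1))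
    (hDC : ∀ u ∈ Icc (0:ℝ) 1, ∀ v ∈ Icc (0:ℝ) 1, D u v = survivalCopula C u v) :
    UnivOptimal P h C := by
  intro X Y X' Y' hX hY hX' hY' hXY hXX' hYY'
  have hle := hmax _ _ _ _ hX.neg hY.neg hX'.neg hY'.neg
    ((hXY.neg hX.1 hY.1 hC).congr hDC) (hXX'.comp measurable_neg) (hYY'.comp measurable_neg)
  rw [distExp_dual_neg_add_neg P h hX.1 hY.1, distExp_dual_neg_add_neg P h hX'.1 hY'.1] at hle
  exact neg_le_neg_iff.1 hle

theorem UnivOptimalWithin.univMaximalWithin_dual (hopt : UnivOptimalWithin P h C 𝒞)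
    (hD : ContinuousOn (fun q : ℝ × ℝ => D q.1 q.2) (Icc 0 1 ×ˢ Icc 0 1))
    (hCD : ∀ u ∈ Icc (0:ℝ) 1, ∀ v ∈ Icc (0:ℝ) 1, C u v = survivalCopula D u v)
    (h𝒟 : ∀ C' ∈ 𝒟, IsCopula C' ∧ survivalCopula C' ∈ 𝒞) :
    UnivMaximalWithin P (fun t => 1 - h (1 - t)) D 𝒟 := by
  rintro X Y X' Y' hX hY hX' hY' hXY ⟨C', hC', hXY'⟩ hXX' hYY'
  rw [distExp_dual_add P h hX.1 hY.1, distExp_dual_add P h hX'.1 hY'.1]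
  exact neg_le_neg (hopt _ _ _ _ hX.neg hY.neg hX'.neg hY'.neg
    ((hXY.neg hX.1 hY.1 hD).congr hCD)
    ⟨_, (h𝒟 C' hC').2, hXY'.neg hX'.1 hY'.1 (h𝒟 C' hC').1.continuousOn⟩
    (hXX'.comp measurable_neg) (hYY'.comp measurable_neg))

theorem UnivMaximalWithin.univOptimalWithin_of_dual
    (hmax : UnivMaximalWithin P (fun t => 1 - h (1 - t)) D 𝒟)
    (hC : ContinuousOn (fun q : ℝ × ℝ => C q.1 q.2) (Icc 0 1 ×ˢ Icc 0 1))
    (hDC : ∀ u ∈ Icc (0:ℝ) 1, ∀ v ∈ Icc (0:ℝ) 1, D u v = survivalCopula C u v)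
    (h𝒞 : ∀ C' ∈ 𝒞, IsCopula C' ∧ survivalCopula C' ∈ 𝒟) :
    UnivOptimalWithin P h C 𝒞 := by
  rintro X Y X' Y' hX hY hX' hY' hXY ⟨C', hC', hXY'⟩ hXX' hYY'
  have hle := hmax _ _ _ _ hX.neg hY.neg hX'.neg hY'.neg
    ((hXY.neg hX.1 hY.1 hC).congr hDC)
    ⟨_, (h𝒞 C' hC').2, hXY'.neg hX'.1 hY'.1 (h𝒞 C' hC').1.continuousOn⟩
    (hXX'.comp measurable_neg) (hYY'.comp measurable_neg)
  rw [distExp_dual_neg_add_neg P h hX.1 hY.1, distExp_dual_neg_add_neg P h hX'.1 hY'.1] at hle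
  exact neg_le_neg_iff.1 hle

end Duality

/-- C^±_p is universally optimal for h iff C^∓_{1-p} is universally maximal
for the dual distortion h̃(t) = 1 - h(1-t); the same equivalence holds with optimality
within 𝒞_p and maximality within 𝒞_{1-p}. -/
theorem univOptimal_Cpm_iff_univMaximal_Cmp_dual
    (P : Measure Ω) [IsProbabilityMeasure P] (hP : AtomlessProb P)
    (h : ℝ → ℝ) (hdist : IsDistortion h)
    (p : ℝ) (hp : p ∈ Ioo (0:ℝ) 1) :
    (UnivOptimal P h (Cpm p) ↔
      UnivMaximal P (fun t => 1 - h (1 - t)) (Cmp (1 - p))) ∧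
    (UnivOptimalWithin P h (Cpm p) (copulaSet p) ↔
      UnivMaximalWithin P (fun t => 1 - h (1 - t)) (Cmp (1 - p)) (copulaSet (1 - p))) := by
  have hC : ∀ u ∈ Icc (0:ℝ) 1, ∀ v ∈ Icc (0:ℝ) 1,
      Cpm p u v = survivalCopula (Cmp (1 - p)) u v :=
    fun u hu v hv => Cpm_eq_survival_Cmp hu hv
  have hD : ∀ u ∈ Icc (0:ℝ) 1, ∀ v ∈ Icc (0:ℝ) 1,
      Cmp (1 - p) u v = survivalCopula (Cpm p) u v :=
    fun u hu v hv => Cmp_eq_survival_Cpm hu hv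
  refine ⟨⟨fun hopt => hopt.univMaximal_dual (continuousOn_Cmp p) hC,
      fun hmax => hmax.univOptimal_of_dual (continuousOn_Cpm p) hD⟩,
    ⟨fun hopt => hopt.univMaximalWithin_dual (continuousOn_Cmp p) hC fun C' hC' =>
        ⟨hC'.1, survivalCopula_mem_copulaSet (sub_add_cancel 1 p) hC'⟩,
      fun hmax => hmax.univOptimalWithin_of_dual (continuousOn_Cpm p) hD fun C' hC' =>
        ⟨hC'.1, survivalCopula_mem_copulaSet (add_sub_cancel p 1) hC'⟩⟩⟩
end
end
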